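/- arXiv:1401.4398 — 4 statements merged into one kernel-verified Lean document; each statement's English description precedes it below -/
import Mathlib

section
/- Distributed descent lemma: Suppose the dual function decomposes as d(λ) = Σ_{i=1}^M d_i(λ_{N_i}) − ⟨λ, g⟩, where λ = (λ_1,…,λ_{M̄}) is partitioned into blocks indexed by j ∈ {1,…,M̄}, N_i ⊆ {1,…,M̄} are index sets, λ_{N_i} = (λ_j)_{j∈N_i}, and each d_i is concave and differentiable with ∇d_i Lipschitz continuous with constant L_{d_i} w.r.t. the Euclidean norm. Let N̄_j = { i : j ∈ N_i }, and let W be the block-diagonal positive definite matrix whose j-th diagonal block equals (Σ_{i∈N̄_j} L_{d_i}) times the identity. Then for all λ, λ̄ ∈ 𝔻, d(λ) ≥ d(λ̄) + ⟨∇d(λ̄), λ − λ̄⟩ − (1/2)‖λ − λ̄‖²_W. -/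
open RealInnerProductSpace

section Descent

variable {E : Type*} [NormedAddCommGroup E] [InnerProductSpace ℝ E] [CompleteSpace E]

theorem HasGradientAt.hasDerivAt_comp_add_smul {f : E → ℝ} {f' a u : E} {t : ℝ}
    (hf : HasGradientAt f f' (a + t • u)) :
    HasDerivAt (fun s : ℝ => f (a + s • u)) ⟪f', u⟫ t := by
  have hline : HasDerivAt (fun s : ℝ => a + s • u) u t := by
    simpa using ((hasDerivAt_id t).smul_const u).const_add a
  simpa [Function.comp_def] using hf.hasFDerivAt.comp_hasDerivAt t hline

/-- A function with `L`-Lipschitz gradient is bounded below by its linearization minus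
`L / 2 * ‖u‖ ^ 2`. -/
theorem descent_of_lipschitz_gradient {f : E → ℝ} {f' : E → E} {L : ℝ}
    (hf : ∀ a, HasGradientAt f (f' a) a) (hlip : ∀ a b, ‖f' a - f' b‖ ≤ L * ‖a - b‖) (a u : E) :
    f a + ⟪f' a, u⟫ - L / 2 * ‖u‖ ^ 2 ≤ f (a + u) := by
  let h : ℝ → ℝ := fun t => f (a + t • u) - t * ⟪f' a, u⟫ + t ^ 2 * (L / 2 * ‖u‖ ^ 2)
  have hderiv : ∀ t, HasDerivAt h
      (⟪f' (a + t • u), u⟫ - 1 * ⟪f' a, u⟫ + (2 * t) * (L / 2 * ‖u‖ ^ 2)) t := by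
    intro t
    have hsq : HasDerivAt (fun s : ℝ => s ^ 2) (2 * t) t := by simpa using hasDerivAt_pow 2 t
    exact ((hf (a + t • u)).hasDerivAt_comp_add_smul.sub
      ((hasDerivAt_id t).mul_const _)).add (hsq.mul_const _)
  have hmono : MonotoneOn h (Set.Icc 0 1) := by
    refine monotoneOn_of_deriv_nonneg (convex_Icc 0 1)
      (fun t _ => (hderiv t).continuousAt.continuousWithinAt)
      (fun t _ => (hderiv t).differentiableAt.differentiableWithinAt) fun t ht => ?_
    rw [interior_Icc] at ht
    rw [(hderiv t).deriv]
    have hcs := (abs_le.mp (abs_real_inner_le_norm (f' (a + t • u) - f' a) u)).1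
    have hnorm := hlip (a + t • u) a
    rw [add_sub_cancel_left, norm_smul, Real.norm_of_nonneg ht.1.le] at hnorm
    have hmul := mul_le_mul_of_nonneg_right hnorm (norm_nonneg u)
    rw [inner_sub_left] at hcs
    nlinarith
  have hle := hmono (Set.left_mem_Icc.mpr zero_le_one) (Set.right_mem_Icc.mpr zero_le_one)
    zero_le_one
  simp only [h, zero_smul, one_smul, add_zero] at hle
  linarith

theorem HasGradientAt.inner_eq_zero_of_const {f : E → ℝ} {f' a v : E}
    (hf : HasGradientAt f f' a) (hv : ∀ t : ℝ, f (a + t • v) = f a) : ⟪f', v⟫ = 0 := by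
  have hline : HasDerivAt (fun s : ℝ => f (a + s • v)) ⟪f', v⟫ 0 :=
    HasGradientAt.hasDerivAt_comp_add_smul (by simpa using hf)
  simp only [hv] at hline
  exact hline.unique (hasDerivAt_const 0 (f a))

end Descent

/-- If `f` depends only on the coordinates satisfying `p`, only these enter the quadratic term
of the descent inequality. -/
theorem descent_of_dependsOn_coordinates {ι : Type*} [Fintype ι] (p : ι → Prop) [DecidablePred p]
    {f : EuclideanSpace ℝ ι → ℝ} {f' : EuclideanSpace ℝ ι → EuclideanSpace ℝ ι} {L : ℝ}
    (hdep : ∀ a b : EuclideanSpace ℝ ι, (∀ x, p x → a x = b x) → f a = f b)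
    (hf : ∀ a, HasGradientAt f (f' a) a) (hlip : ∀ a b, ‖f' a - f' b‖ ≤ L * ‖a - b‖)
    (a b : EuclideanSpace ℝ ι) :
    f a + ⟪f' a, b - a⟫ - 1 / 2 * ∑ x, (if p x then L else 0) * (b x - a x) ^ 2 ≤ f b := by
  let u : EuclideanSpace ℝ ι := WithLp.toLp 2 fun x => if p x then b x - a x else 0
  have hu : ∀ x, u x = if p x then b x - a x else 0 := fun _ => rfl
  have hfb : f (a + u) = f b := hdep _ _ fun x hx => by simp [hu, hx]
  have hinner : ⟪f' a, b - a - u⟫ = 0 := (hf a).inner_eq_zero_of_const fun t =>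
    hdep _ _ fun x hx => by simp [hu, hx]
  have hnorm : L * ‖u‖ ^ 2 = ∑ x, (if p x then L else 0) * (b x - a x) ^ 2 := by
    rw [EuclideanSpace.real_norm_sq_eq, Finset.mul_sum]
    refine Finset.sum_congr rfl fun x _ => ?_
    rw [hu]
    split_ifs <;> simp
  have hdesc := descent_of_lipschitz_gradient hf hlip a u
  rw [inner_sub_right] at hinner
  rw [hfb] at hdesc
  linarith

/-- Distributed descent lemma.  The dual variable `λ` has coordinates
indexed by `ι`, each coordinate `x : ι` belonging to the block `blk x ∈ {1,…,M̄}`; the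
dual function decomposes as `d(λ) = Σ_{i=1}^M d_i(λ_{N_i}) - ⟨λ, g⟩` where each `d_i`
depends only on the coordinates in the blocks `N_i` and is concave and differentiable with
`L_{d_i}`-Lipschitz gradient w.r.t. the Euclidean norm.  With `N̄_j = {i : j ∈ N_i}` and
`W` the block diagonal matrix whose `j`-th diagonal block is `(Σ_{i ∈ N̄_j} L_{d_i}) I`,
one has `d(λ) ≥ d(λ̄) + ⟨∇d(λ̄), λ - λ̄⟩ - (1/2)‖λ - λ̄‖²_W` for all `λ, λ̄ ∈ 𝔻`, where
`∇d(λ̄) = Σ_i ∇d_i(λ̄_{N_i}) - g` and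
`‖u‖²_W = Σ_x (Σ_{i : blk x ∈ N_i} L_{d_i}) u_x²`. -/
theorem stmt0
    {M Mbar : ℕ} {ι : Type} [Fintype ι]
    -- block structure of the dual variables:
    (blk : ι → Fin Mbar)
    -- index sets `N_i ⊆ {1,…,M̄}` describing the local information flow:
    (N : Fin M → Finset (Fin Mbar))
    -- component functions `d_i`, their gradients, and the Lipschitz constants `L_{d_i}`:
    (dcomp : Fin M → EuclideanSpace ℝ ι → ℝ)
    (gradd : Fin M → EuclideanSpace ℝ ι → EuclideanSpace ℝ ι)
    (L : Fin M → ℝ) (hL : ∀ i, 0 ≤ L i)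
    (g : EuclideanSpace ℝ ι)
    -- the coordinates carrying nonnegativity constraints, so that
    -- `𝔻 = {λ | ∀ x ∈ Ineq, 0 ≤ λ x} ≃ ℝ^p × ℝ^q₊`:
    (Ineq : Set ι)
    -- `d_i(λ) = d_i(λ_{N_i})` depends only on the coordinates in the blocks `N_i`:
    (hdep : ∀ i, ∀ a b : EuclideanSpace ℝ ι,
        (∀ x : ι, blk x ∈ N i → a x = b x) → dcomp i a = dcomp i b)
    -- each `d_i` is concave and differentiable with `L_{d_i}`-Lipschitz gradient:
    (hconc : ∀ i, ConcaveOn ℝ Set.univ (dcomp i))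
    (hdiff : ∀ i a, HasGradientAt (dcomp i) (gradd i a) a)
    (hlip : ∀ i, ∀ a b : EuclideanSpace ℝ ι, ‖gradd i a - gradd i b‖ ≤ L i * ‖a - b‖)
    -- the dual function `d(λ) = Σ_i d_i(λ_{N_i}) - ⟨λ, g⟩`:
    (d : EuclideanSpace ℝ ι → ℝ)
    (hdfun : ∀ a : EuclideanSpace ℝ ι, d a = (∑ i, dcomp i a) - ⟪a, g⟫)
    : ∀ lam lambar : EuclideanSpace ℝ ι,
      (∀ x ∈ Ineq, (0 : ℝ) ≤ lam x) → (∀ x ∈ Ineq, (0 : ℝ) ≤ lambar x) →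
      d lambar + ((∑ i, ⟪gradd i lambar, lam - lambar⟫) - ⟪g, lam - lambar⟫)
          - 1 / 2 * ∑ x : ι, (∑ i, if blk x ∈ N i then L i else 0) * (lam x - lambar x) ^ 2
        ≤ d lam := by
  intro lam lambar _ _
  have hsum := Finset.sum_le_sum fun i (_ : i ∈ Finset.univ) =>
    descent_of_dependsOn_coordinates (fun x => blk x ∈ N i) (hdep i) (hdiff i) (hlip i) lambar lam
  rw [Finset.sum_sub_distrib, Finset.sum_add_distrib, ← Finset.mul_sum, Finset.sum_comm] at hsum
  simp only [← Finset.sum_mul] at hsum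
  rw [hdfun, hdfun, inner_sub_right g, real_inner_comm g lam, real_inner_comm g lambar]
  linarith
end

section
/- Gradient / gradient-map inequality: for every λ, ω ∈ 𝔻, ⟨∇d(ω) − ∇d(λ), λ − ω⟩ ≤ 2 ‖∇⁺d(λ) − ∇⁺d(ω)‖_W · ‖λ − ω‖_W. -/
open Finset

/-- Euclidean norm of a finite-dimensional real vector. -/
noncomputable def enorm {ι : Type*} [Fintype ι] (x : ι → ℝ) : ℝ :=
  Real.sqrt (∑ i, x i ^ 2)

/-- Weighted norm `‖x‖_W` for the diagonal positive definite matrix `W = diag w`. -/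
noncomputable def wnorm {ι : Type*} [Fintype ι] (w x : ι → ℝ) : ℝ :=
  Real.sqrt (∑ i, w i * x i ^ 2)

/-- Weighted norm `‖x‖_{W⁻¹}` for the diagonal positive definite matrix `W = diag w`. -/
noncomputable def wnormInv {ι : Type*} [Fintype ι] (w x : ι → ℝ) : ℝ :=
  Real.sqrt (∑ i, x i ^ 2 / w i)

/-- Euclidean inner product. -/
def dotp {ι : Type*} [Fintype ι] (x y : ι → ℝ) : ℝ := ∑ i, x i * y i

/-- Euclidean projection onto `𝔻 = ℝ^p × ℝ^q₊` (identity on the first block,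
componentwise positive part on the second block).  Since the matrices `W` below are
diagonal, this coincides with the projection in the norm `‖·‖_W`. -/
def projD {p q : ℕ} (v : Fin p ⊕ Fin q → ℝ) : Fin p ⊕ Fin q → ℝ :=
  Sum.elim (fun i => v (Sum.inl i)) (fun j => max (v (Sum.inr j)) 0)

/-- Weighted norm `‖x‖_W = √(xᵀWx)` for a (not necessarily diagonal) matrix `W`. -/
noncomputable def wnormM {ι : Type*} [Fintype ι] (W : Matrix ι ι ℝ) (x : ι → ℝ) : ℝ :=
  Real.sqrt (∑ i, x i * W.mulVec x i)

open Matrix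

section WeightedNorm

variable {ι : Type*} [Fintype ι] {W : Matrix ι ι ℝ}

theorem wnormM_eq_sqrt (W : Matrix ι ι ℝ) (x : ι → ℝ) :
    wnormM W x = Real.sqrt (x ⬝ᵥ W *ᵥ x) := rfl

theorem wnormM_nonneg (W : Matrix ι ι ℝ) (x : ι → ℝ) : 0 ≤ wnormM W x :=
  Real.sqrt_nonneg _

theorem Matrix.PosDef.dotProduct_mulVec_self_nonneg (hW : W.PosDef) (x : ι → ℝ) :
    0 ≤ x ⬝ᵥ W *ᵥ x := by
  simpa using hW.posSemidef.dotProduct_mulVec_nonneg x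

theorem Matrix.PosDef.dotProduct_mulVec_comm (hW : W.PosDef) (x y : ι → ℝ) :
    x ⬝ᵥ W *ᵥ y = y ⬝ᵥ W *ᵥ x := by
  have hsymm : Wᵀ = W := by simpa using hW.isHermitian.eq
  rw [dotProduct_mulVec, ← mulVec_transpose, hsymm, dotProduct_comm]

theorem wnormM_sq (hW : W.PosDef) (x : ι → ℝ) : wnormM W x ^ 2 = x ⬝ᵥ W *ᵥ x :=
  Real.sq_sqrt (hW.dotProduct_mulVec_self_nonneg x)

/-- Cauchy–Schwarz inequality for the inner product induced by `W`. -/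
theorem abs_dotProduct_mulVec_le_wnormM_mul (hW : W.PosDef) (x y : ι → ℝ) :
    |x ⬝ᵥ W *ᵥ y| ≤ wnormM W x * wnormM W y := by
  refine abs_le_of_sq_le_sq ?_ (mul_nonneg (wnormM_nonneg W x) (wnormM_nonneg W y))
  rw [mul_pow, wnormM_sq hW, wnormM_sq hW]
  have hdisc := discrim_le_zero (a := y ⬝ᵥ W *ᵥ y) (b := 2 * (x ⬝ᵥ W *ᵥ y))
    (c := x ⬝ᵥ W *ᵥ x) fun t => by
      have h := hW.dotProduct_mulVec_self_nonneg (x + t • y)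
      simp only [mulVec_add, mulVec_smul, add_dotProduct, dotProduct_add, smul_dotProduct,
        dotProduct_smul, smul_eq_mul, hW.dotProduct_mulVec_comm y x] at h
      linarith
  rw [discrim] at hdisc
  linarith

theorem wnormM_inv_mulVec [DecidableEq ι] (hW : W.PosDef) (x : ι → ℝ) :
    wnormM W (W⁻¹ *ᵥ x) = wnormM W⁻¹ x := by
  have hdet : IsUnit W.det := hW.det_pos.ne'.isUnit
  rw [wnormM_eq_sqrt, wnormM_eq_sqrt, mulVec_mulVec, mul_nonsing_inv _ hdet, one_mulVec,
    dotProduct_comm]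

/-- Variational inequality for a `W`-nearest point `z` of a convex set to `v`. -/
theorem dotProduct_mulVec_nonneg_of_wnormM_minimal (hW : W.PosDef) {C : Set (ι → ℝ)}
    (hC : Convex ℝ C) {v z x : ι → ℝ} (hz : z ∈ C) (hx : x ∈ C)
    (hmin : ∀ y ∈ C, wnormM W (z - v) ≤ wnormM W (y - v)) :
    0 ≤ (x - z) ⬝ᵥ W *ᵥ (z - v) := by
  by_contra! hneg
  set b := (x - z) ⬝ᵥ W *ᵥ (z - v) with hb
  set c := (x - z) ⬝ᵥ W *ᵥ (x - z) with hc
  have hc0 : 0 ≤ c := hW.dotProduct_mulVec_self_nonneg _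
  have hcb : 0 < c - b := by linarith
  set t := -b / (c - b) with ht
  have ht0 : 0 < t := div_pos (by linarith) hcb
  have ht1 : t ≤ 1 := (div_le_one hcb).2 (by linarith)
  have htb : t * (c - b) = -b := div_mul_cancel₀ _ hcb.ne'
  have h := pow_le_pow_left₀ (wnormM_nonneg W _)
    (hmin _ (hC.add_smul_sub_mem hz hx ⟨ht0.le, ht1⟩)) 2
  rw [wnormM_sq hW, wnormM_sq hW,
    show z + t • (x - z) - v = (z - v) + t • (x - z) by abel] at h
  simp only [mulVec_add, mulVec_smul, add_dotProduct, dotProduct_add, smul_dotProduct,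
    dotProduct_smul, smul_eq_mul, hW.dotProduct_mulVec_comm (z - v) (x - z), ← hb, ← hc] at h
  have hprod : 0 ≤ t * (2 * b + t * c) := by linarith
  have hfactor : 0 ≤ 2 * b + t * c := nonneg_of_mul_nonneg_right hprod ht0
  nlinarith

/-- Firm nonexpansiveness of `W`-nearest points of a convex set. -/
theorem dotProduct_mulVec_sub_nonneg_of_wnormM_minimal (hW : W.PosDef) {C : Set (ι → ℝ)}
    (hC : Convex ℝ C) {v₁ v₂ z₁ z₂ : ι → ℝ} (hz₁ : z₁ ∈ C) (hz₂ : z₂ ∈ C)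
    (hmin₁ : ∀ y ∈ C, wnormM W (z₁ - v₁) ≤ wnormM W (y - v₁))
    (hmin₂ : ∀ y ∈ C, wnormM W (z₂ - v₂) ≤ wnormM W (y - v₂)) :
    0 ≤ (z₁ - z₂) ⬝ᵥ W *ᵥ ((v₁ - v₂) - (z₁ - z₂)) := by
  have h₁ := dotProduct_mulVec_nonneg_of_wnormM_minimal hW hC hz₁ hz₂ hmin₁
  have h₂ := dotProduct_mulVec_nonneg_of_wnormM_minimal hW hC hz₂ hz₁ hmin₂
  simp only [mulVec_sub, sub_dotProduct, dotProduct_sub] at h₁ h₂ ⊢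
  linarith

end WeightedNorm

theorem convex_setOf_inr_nonneg (α β : Type*) :
    Convex ℝ {x : α ⊕ β → ℝ | ∀ j, 0 ≤ x (Sum.inr j)} := by
  intro x hx y hy a b ha hb _ j
  exact add_nonneg (mul_nonneg ha (hx j)) (mul_nonneg hb (hy j))

/-- Gradient / gradient-map inequality: for every `λ, ω ∈ 𝔻`,
`⟨∇d(ω) - ∇d(λ), λ - ω⟩ ≤ 2‖∇⁺d(λ) - ∇⁺d(ω)‖_W ‖λ - ω‖_W`, where
`∇⁺d(λ) = [λ + W⁻¹∇d(λ)]^W_𝔻 - λ` and `[·]^W_𝔻` is the projection onto `𝔻` in the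
norm `‖·‖_W`. -/
theorem stmt10
    {p q : ℕ}
    -- `d` is a concave differentiable function with gradient `grad` and `W`-Lipschitz
    -- gradient (Assumption on Lipschitz continuity of `∇d`):
    (d : (Fin p ⊕ Fin q → ℝ) → ℝ)
    (grad : (Fin p ⊕ Fin q → ℝ) → Fin p ⊕ Fin q → ℝ)
    (hconc : ∀ a b : Fin p ⊕ Fin q → ℝ, d b ≤ d a + dotp (grad a) (b - a))
    (W : Matrix (Fin p ⊕ Fin q) (Fin p ⊕ Fin q) ℝ) (hW : W.PosDef)
    (hLip : ∀ a b : Fin p ⊕ Fin q → ℝ,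
        wnormM W⁻¹ (grad a - grad b) ≤ wnormM W (a - b))
    -- `projW v = [v]^W_𝔻` is the projection onto `𝔻 = ℝ^p × ℝ^q₊` w.r.t. `‖·‖_W`:
    (projW : (Fin p ⊕ Fin q → ℝ) → Fin p ⊕ Fin q → ℝ)
    (hprojW : ∀ v : Fin p ⊕ Fin q → ℝ, (∀ j, 0 ≤ projW v (Sum.inr j))
        ∧ ∀ xi : Fin p ⊕ Fin q → ℝ, (∀ j, 0 ≤ xi (Sum.inr j)) →
            wnormM W (projW v - v) ≤ wnormM W (xi - v))
    : ∀ lam om : Fin p ⊕ Fin q → ℝ,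
      (∀ j, 0 ≤ lam (Sum.inr j)) → (∀ j, 0 ≤ om (Sum.inr j)) →
      dotp (grad om - grad lam) (lam - om)
        ≤ 2 * wnormM W ((projW (lam + W⁻¹.mulVec (grad lam)) - lam)
              - (projW (om + W⁻¹.mulVec (grad om)) - om))
          * wnormM W (lam - om) := by
  intro lam om _ _
  have hfirm := dotProduct_mulVec_sub_nonneg_of_wnormM_minimal hW
    (convex_setOf_inr_nonneg (Fin p) (Fin q))
    (hprojW (lam + W⁻¹ *ᵥ grad lam)).1 (hprojW (om + W⁻¹ *ᵥ grad om)).1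
    (hprojW (lam + W⁻¹ *ᵥ grad lam)).2 (hprojW (om + W⁻¹ *ᵥ grad om)).2
  set z₁ := projW (lam + W⁻¹ *ᵥ grad lam)
  set z₂ := projW (om + W⁻¹ *ᵥ grad om)
  set u := lam - om with hu
  set e := (z₁ - lam) - (z₂ - om) with he
  set g := W⁻¹ *ᵥ (grad lam - grad om) with hg
  have hz : z₁ - z₂ = u + e := by rw [hu, he]; abel
  have hv : (lam + W⁻¹ *ᵥ grad lam) - (om + W⁻¹ *ᵥ grad om) - (z₁ - z₂) = g - e := by
    rw [hz, hu, hg, mulVec_sub]; abel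
  rw [hv, hz] at hfirm
  have hgrad : dotp (grad om - grad lam) u = -(u ⬝ᵥ W *ᵥ g) := by
    have hdet : IsUnit W.det := hW.det_pos.ne'.isUnit
    rw [hg, mulVec_mulVec, mul_nonsing_inv _ hdet, one_mulVec, dotProduct_comm,
      ← neg_dotProduct, neg_sub]
    rfl
  have hgu : wnormM W g ≤ wnormM W u := (wnormM_inv_mulVec hW _).trans_le (hLip lam om)
  have hue := neg_le_of_abs_le (abs_dotProduct_mulVec_le_wnormM_mul hW u e)
  have heg := le_of_abs_le (abs_dotProduct_mulVec_le_wnormM_mul hW e g)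
  have hee := hW.dotProduct_mulVec_self_nonneg e
  have hmul := mul_le_mul_of_nonneg_left hgu (wnormM_nonneg W e)
  simp only [mulVec_sub, add_dotProduct, dotProduct_sub] at hfirm
  rw [hgrad]
  linarith
end

section
/- Fejér monotonicity of the distributed dual gradient method (DG): if λ^{k+1} = [λ^k + W⁻¹ ∇d(λ^k)]_𝔻 for all k ≥ 0, then for every dual optimal λ* ∈ Λ* and every k ≥ 0, ‖λ^{k+1} − λ*‖_W ≤ ‖λ^k − λ*‖_W; in particular ‖λ^k − λ*‖_W ≤ ‖λ⁰ − λ*‖_W for all k. -/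
open Finset

lemma wnorm_sq {ι : Type*} [Fintype ι] {w : ι → ℝ} (hw : ∀ i, 0 < w i) (x : ι → ℝ) :
    wnorm w x ^ 2 = ∑ i, w i * x i ^ 2 :=
  Real.sq_sqrt (sum_nonneg fun i _ => mul_nonneg (hw i).le (sq_nonneg _))

lemma projD_inr_nonneg {p q : ℕ} (v : Fin p ⊕ Fin q → ℝ) (j : Fin q) :
    0 ≤ projD v (Sum.inr j) :=
  le_max_right _ _

/-- Coordinatewise variational inequality characterizing the projection onto `𝔻`. -/
lemma projD_variational {p q : ℕ} (v s : Fin p ⊕ Fin q → ℝ)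
    (hs : ∀ j, 0 ≤ s (Sum.inr j)) (i : Fin p ⊕ Fin q) :
    0 ≤ (projD v i - v i) * (s i - projD v i) := by
  rcases i with i | j
  · simp [projD]
  · have := hs j
    simp only [projD, Sum.elim_inr]
    rcases le_total (v (Sum.inr j)) 0 with h | h
    · rw [max_eq_right h]
      nlinarith
    · simp [max_eq_left h]

/-- Three-point inequality for a projected gradient step in the metric `W = diag w`. -/
lemma dotp_sub_projD_le {p q : ℕ} {w : Fin p ⊕ Fin q → ℝ} (hw : ∀ i, 0 < w i)
    (x g s y : Fin p ⊕ Fin q → ℝ) (hs : ∀ j, 0 ≤ s (Sum.inr j))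
    (hy : y = projD fun i => x i + g i / w i) :
    2 * (dotp g (s - x) - dotp g (y - x)) ≤
      wnorm w (x - s) ^ 2 - wnorm w (y - x) ^ 2 - wnorm w (y - s) ^ 2 := by
  simp only [wnorm_sq hw, dotp, ← sum_sub_distrib, mul_sum, Pi.sub_apply]
  refine sum_le_sum fun i _ => ?_
  have h := projD_variational (fun i => x i + g i / w i) s hs i
  rw [← hy] at h
  have hmul := mul_nonneg (hw i).le h
  have hcancel : w i * ((y i - (x i + g i / w i)) * (s i - y i)) =
      (w i * (y i - x i) - g i) * (s i - y i) := by
    have := (hw i).ne'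
    field_simp
    ring
  rw [hcancel] at hmul
  linarith

/-- Fejér monotonicity of the distributed dual gradient method (DG):
if `λ^{k+1} = [λ^k + W⁻¹∇d(λ^k)]_𝔻` for all `k ≥ 0`, then for every dual optimal
`λ* ∈ Λ*` and every `k ≥ 0`, `‖λ^{k+1} - λ*‖_W ≤ ‖λ^k - λ*‖_W`; in particular
`‖λ^k - λ*‖_W ≤ ‖λ⁰ - λ*‖_W` for all `k`. -/
theorem stmt14
    {p q : ℕ}
    (d : (Fin p ⊕ Fin q → ℝ) → ℝ)
    (grad : (Fin p ⊕ Fin q → ℝ) → Fin p ⊕ Fin q → ℝ)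
    (w : Fin p ⊕ Fin q → ℝ) (hw : ∀ x, 0 < w x)
    -- `d` is concave and differentiable on `𝔻 = ℝ^p × ℝ^q₊`:
    (hconc : ∀ a b : Fin p ⊕ Fin q → ℝ,
        (∀ j, 0 ≤ a (Sum.inr j)) → (∀ j, 0 ≤ b (Sum.inr j)) →
        d b ≤ d a + dotp (grad a) (b - a))
    -- descent inequality for the diagonal positive definite matrix `W = diag w`:
    (hdesc : ∀ a b : Fin p ⊕ Fin q → ℝ,
        (∀ j, 0 ≤ a (Sum.inr j)) → (∀ j, 0 ≤ b (Sum.inr j)) →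
        d a + dotp (grad a) (b - a) - 1 / 2 * wnorm w (b - a) ^ 2 ≤ d b)
    -- `Λ*` is the nonempty set of maximizers of `d` over `𝔻`:
    (Lamstar : Set (Fin p ⊕ Fin q → ℝ))
    (hLamstar : Lamstar = {l | (∀ j, 0 ≤ l (Sum.inr j))
        ∧ ∀ m : Fin p ⊕ Fin q → ℝ, (∀ j, 0 ≤ m (Sum.inr j)) → d m ≤ d l})
    (hne : Lamstar.Nonempty)
    -- Algorithm (DG):
    (lam : ℕ → Fin p ⊕ Fin q → ℝ)
    (hlamD : ∀ j, 0 ≤ lam 0 (Sum.inr j))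
    (hrec : ∀ k : ℕ, lam (k + 1) = projD (fun x => lam k x + grad (lam k) x / w x))
    : ∀ ls ∈ Lamstar, ∀ k : ℕ,
      wnorm w (lam (k + 1) - ls) ≤ wnorm w (lam k - ls)
      ∧ wnorm w (lam k - ls) ≤ wnorm w (lam 0 - ls) := by
  subst hLamstar
  rintro ls ⟨hls, hmax⟩
  have hmem : ∀ k j, 0 ≤ lam k (Sum.inr j) := by
    rintro (_ | k) j
    · exact hlamD j
    · rw [hrec]
      exact projD_inr_nonneg _ j
  have hstep : ∀ k, wnorm w (lam (k + 1) - ls) ≤ wnorm w (lam k - ls) := by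
    intro k
    have hthree := dotp_sub_projD_le hw (lam k) (grad (lam k)) ls _ hls (hrec k)
    have hlower := hdesc _ _ (hmem k) (hmem (k + 1))
    have hupper := hconc _ _ (hmem k) hls
    have hopt := hmax _ (hmem (k + 1))
    refine (sq_le_sq₀ (Real.sqrt_nonneg _) (Real.sqrt_nonneg _)).mp ?_
    change wnorm w (lam (k + 1) - ls) ^ 2 ≤ wnorm w (lam k - ls) ^ 2
    linarith
  exact fun k => ⟨hstep k, antitone_nat_of_succ_le (f := fun k => wnorm w (lam k - ls)) hstep
    (Nat.zero_le k)⟩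
end

section
/- Projected-gradient residual dominates the projected gradient: let W be a diagonal positive definite matrix, 𝔻 = ℝ^p × ℝ^q₊, λ ∈ 𝔻 and v ∈ ℝ^{p+q}, and set λ⁺ = [λ + W⁻¹ v]_𝔻. Then ‖[v]_𝔻‖_{W⁻¹} ≤ ‖λ − λ⁺‖_W, where [v]_𝔻 = (v_ν, [v_μ]₊) for v = (v_ν, v_μ) ∈ ℝ^p × ℝ^q, with [·]₊ the componentwise positive part. -/
open Finset

/-- For an exact (unconstrained) coordinate, the scaled gradient and the step agree. -/
theorem sq_div_eq_mul_sq_sub_add_div {w : ℝ} (hw : 0 < w) (l v : ℝ) :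
    v ^ 2 / w = w * (l - (l + v / w)) ^ 2 := by
  field_simp
  ring

/-- For a nonnegative coordinate, the scaled positive part of the gradient is dominated by
the projected step. -/
theorem max_sq_div_le_mul_sq_sub_max {w l : ℝ} (hw : 0 < w) (hl : 0 ≤ l) (v : ℝ) :
    max v 0 ^ 2 / w ≤ w * (l - max (l + v / w) 0) ^ 2 := by
  rcases le_total v 0 with hv | hv
  · rw [max_eq_right hv]
    simp only [ne_eq, OfNat.ofNat_ne_zero, not_false_eq_true, zero_pow, zero_div]
    positivity
  · have hstep : 0 ≤ l + v / w := by positivity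
    rw [max_eq_left hv, max_eq_left hstep]
    exact (sq_div_eq_mul_sq_sub_add_div hw l v).le

/-- Projected-gradient residual dominates the projected gradient: let
`W = diag w` be a diagonal positive definite matrix, `𝔻 = ℝ^p × ℝ^q₊`, `λ ∈ 𝔻` and
`v ∈ ℝ^{p+q}`, and set `λ⁺ = [λ + W⁻¹v]_𝔻`.  Then `‖[v]_𝔻‖_{W⁻¹} ≤ ‖λ - λ⁺‖_W`. -/
theorem stmt19
    {p q : ℕ}
    (w : Fin p ⊕ Fin q → ℝ) (hw : ∀ x, 0 < w x)
    (lam v : Fin p ⊕ Fin q → ℝ)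
    (hlam : ∀ j, 0 ≤ lam (Sum.inr j))
    : wnormInv w (projD v) ≤ wnorm w (lam - projD (fun x => lam x + v x / w x)) := by
  refine Real.sqrt_le_sqrt (Finset.sum_le_sum fun x _ => ?_)
  rcases x with i | j
  · exact (sq_div_eq_mul_sq_sub_add_div (hw _) _ _).le
  · exact max_sq_div_le_mul_sq_sub_max (hw _) (hlam j) _
end
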